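/- arXiv:2101.03800 — 9 statements merged into one kernel-verified Lean document; each statement's English description precedes it below -/
import Mathlib

section
/- For all integers p ≥ 2 and q ≥ 2, F(p)·F(q) ≤ F(p+q−1) − 1. Moreover, if in addition p ≥ 4 or q ≥ 4, then F(p)·F(q) < F(p+q−1) − 1. -/
namespace MatchingCutPaper

/-- The set of edges of `G` with one endpoint in `A` and the other endpoint outside `A`. -/
def cutEdges {V : Type} (G : SimpleGraph V) (A : Set V) : Set (Sym2 V) :=
  {e | e ∈ G.edgeSet ∧ ∃ u v : V, e = s(u, v) ∧ u ∈ A ∧ v ∉ A}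

/-- `M` is a matching of `G`: a set of edges of `G`, no two of which share an endpoint. -/
def IsMatchingSet {V : Type} (G : SimpleGraph V) (M : Set (Sym2 V)) : Prop :=
  M ⊆ G.edgeSet ∧ ∀ e ∈ M, ∀ f ∈ M, e ≠ f → ∀ v : V, ¬(v ∈ e ∧ v ∈ f)

/-- `M` is a matching cut of `G`: a matching of the form `E(A, B)` for a partition `{A, B}`
of the vertex set into two nonempty parts. -/
def IsMatchingCut {V : Type} (G : SimpleGraph V) (M : Set (Sym2 V)) : Prop :=
  IsMatchingSet G M ∧ ∃ A : Set V, A.Nonempty ∧ Aᶜ.Nonempty ∧ M = cutEdges G A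

/-- A matching cut is minimal if no proper subset of it is a matching cut. -/
def IsMinimalMatchingCut {V : Type} (G : SimpleGraph V) (M : Set (Sym2 V)) : Prop :=
  IsMatchingCut G M ∧ ∀ M' : Set (Sym2 V), M' ⊂ M → ¬ IsMatchingCut G M'

/-- A matching cut is maximal if no proper superset of it is a matching cut. -/
def IsMaximalMatchingCut {V : Type} (G : SimpleGraph V) (M : Set (Sym2 V)) : Prop :=
  IsMatchingCut G M ∧ ∀ M' : Set (Sym2 V), M ⊂ M' → ¬ IsMatchingCut G M'

/-- For all integers `p, q ≥ 2`, `F(p) * F(q) ≤ F(p + q - 1) - 1`; moreover if `p ≥ 4` or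
`q ≥ 4` the inequality is strict.  Here `Nat.fib` is the Fibonacci sequence with
`Nat.fib 1 = Nat.fib 2 = 1`. -/
theorem fib_mul_fib_le (p q : ℕ) (hp : 2 ≤ p) (hq : 2 ≤ q) :
    Nat.fib p * Nat.fib q ≤ Nat.fib (p + q - 1) - 1 ∧
      ((4 ≤ p ∨ 4 ≤ q) → Nat.fib p * Nat.fib q < Nat.fib (p + q - 1) - 1) := by
  obtain ⟨m, rfl⟩ : ∃ m, p = m + 1 := ⟨p - 1, by omega⟩
  obtain ⟨n, rfl⟩ : ∃ n, q = n + 1 := ⟨q - 1, by omega⟩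
  have hadd : Nat.fib (m + 1 + (n + 1) - 1) =
      Nat.fib m * Nat.fib n + Nat.fib (m + 1) * Nat.fib (n + 1) := by
    rw [show m + 1 + (n + 1) - 1 = m + n + 1 by omega, Nat.fib_add]
  have hm : 1 ≤ Nat.fib m := Nat.fib_pos.2 (by omega)
  have hn : 1 ≤ Nat.fib n := Nat.fib_pos.2 (by omega)
  have hmn : 1 * 1 ≤ Nat.fib m * Nat.fib n := Nat.mul_le_mul hm hn
  rw [hadd]
  refine ⟨by omega, ?_⟩
  rintro (h | h)
  · have h2 : 2 ≤ Nat.fib m := Nat.fib_mono (show 3 ≤ m by omega)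
    have := Nat.mul_le_mul h2 hn
    omega
  · have h2 : 2 ≤ Nat.fib n := Nat.fib_mono (show 3 ≤ n by omega)
    have := Nat.mul_le_mul hm h2
    omega

end MatchingCutPaper
end

section
/- For every positive integer n, the path graph P_n on n vertices has exactly F(n+1) − 1 matching cuts. -/
namespace MatchingCutPaper

/-- The subsets of `{0, …, m - 1}` that contain no two consecutive numbers. -/
def sparseSubsets (m : ℕ) : Finset (Finset ℕ) :=
  (Finset.range m).powerset.filter fun S => ∀ i ∈ S, i + 1 ∉ S

theorem mem_sparseSubsets {m : ℕ} {S : Finset ℕ} :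
    S ∈ sparseSubsets m ↔ (∀ i ∈ S, i < m) ∧ ∀ i ∈ S, i + 1 ∉ S := by
  simp [sparseSubsets, Finset.subset_iff]

theorem sparseSubsets_add_two (m : ℕ) :
    sparseSubsets (m + 2) =
      sparseSubsets (m + 1) ∪ (sparseSubsets m).image (insert (m + 1)) := by
  ext S
  simp only [Finset.mem_union, Finset.mem_image, mem_sparseSubsets]
  constructor
  · rintro ⟨hlt, hsp⟩
    by_cases hm : m + 1 ∈ S
    · refine Or.inr ⟨S.erase (m + 1), ⟨fun i hi => ?_, fun i hi => ?_⟩, Finset.insert_erase hm⟩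
      · have hiS := Finset.mem_of_mem_erase hi
        have hne := Finset.ne_of_mem_erase hi
        have := hlt i hiS
        have : i ≠ m := by rintro rfl; exact hsp _ hiS hm
        omega
      · exact fun h => hsp i (Finset.mem_of_mem_erase hi) (Finset.mem_of_mem_erase h)
    · refine Or.inl ⟨fun i hi => ?_, hsp⟩
      have := hlt i hi
      have : i ≠ m + 1 := by rintro rfl; exact hm hi
      omega
  · rintro (⟨hlt, hsp⟩ | ⟨T, ⟨hlt, hsp⟩, rfl⟩)
    · exact ⟨fun i hi => (hlt i hi).trans (by omega), hsp⟩
    · refine ⟨fun i hi => ?_, fun i hi h => ?_⟩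
      · rcases Finset.mem_insert.1 hi with rfl | hi
        · omega
        · have := hlt i hi
          omega
      · rcases Finset.mem_insert.1 hi with rfl | hi <;> rcases Finset.mem_insert.1 h with h | h
        · omega
        · have := hlt _ h
          omega
        · have := hlt _ hi
          omega
        · exact hsp i hi h

theorem card_sparseSubsets (m : ℕ) : (sparseSubsets m).card = Nat.fib (m + 2) := by
  induction m using Nat.twoStepInduction with
  | zero => decide
  | one => decide
  | more m ih₀ ih₁ =>
    have hnot : ∀ S ∈ sparseSubsets m, m + 1 ∉ S := fun S hS h => by
      have := (mem_sparseSubsets.1 hS).1 _ h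
      omega
    rw [sparseSubsets_add_two, Finset.card_union_of_disjoint, Finset.card_image_of_injOn, ih₀, ih₁,
      Nat.fib_add_two (n := m + 2), Nat.add_comm]
    · intro S hS T hT h
      rw [← Finset.erase_insert (hnot S hS), ← Finset.erase_insert (hnot T hT)]
      exact congrArg (fun U => Finset.erase U (m + 1)) h
    · refine Finset.disjoint_left.2 fun S hS hS' => ?_
      obtain ⟨T, -, rfl⟩ := Finset.mem_image.1 hS'
      exact absurd ((mem_sparseSubsets.1 hS).1 _ (Finset.mem_insert_self _ _)) (lt_irrefl _)

/-- The edges `{i, i + 1}` of the path graph on `n` vertices with `i ∈ S`. -/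
def pathEdges (n : ℕ) (S : Finset ℕ) : Set (Sym2 (Fin n)) :=
  {e | ∃ u v : Fin n, e = s(u, v) ∧ u.val + 1 = v.val ∧ u.val ∈ S}

theorem mk_mem_pathEdges {n : ℕ} {S : Finset ℕ} {u v : Fin n} (h : u.val + 1 = v.val) :
    s(u, v) ∈ pathEdges n S ↔ u.val ∈ S := by
  refine ⟨?_, fun hu => ⟨u, v, rfl, h, hu⟩⟩
  rintro ⟨a, b, hab, hlt, ha⟩
  rcases Sym2.eq_iff.1 hab with ⟨rfl, rfl⟩ | ⟨rfl, rfl⟩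
  · exact ha
  · omega

theorem exists_eq_mk_of_mem_edgeSet_pathGraph {n : ℕ} {e : Sym2 (Fin n)}
    (he : e ∈ (SimpleGraph.pathGraph n).edgeSet) :
    ∃ u v : Fin n, e = s(u, v) ∧ u.val + 1 = v.val := by
  induction e with
  | _ u v =>
    rcases SimpleGraph.pathGraph_adj.1 ((SimpleGraph.mem_edgeSet _).1 he) with h | h
    · exact ⟨u, v, rfl, h⟩
    · exact ⟨v, u, Sym2.eq_swap, h⟩

theorem pathEdges_injOn (m : ℕ) :
    Set.InjOn (pathEdges (m + 1)) {S : Finset ℕ | ∀ i ∈ S, i < m} := by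
  intro S hS T hT h
  ext i
  by_cases hi : i < m
  · have key : ∀ U, s((⟨i, by omega⟩ : Fin (m + 1)), ⟨i + 1, by omega⟩) ∈ pathEdges (m + 1) U ↔
        i ∈ U := fun U => mk_mem_pathEdges rfl
    rw [← key, ← key, h]
  · exact ⟨fun h' => absurd (hS i h') hi, fun h' => absurd (hT i h') hi⟩

theorem mk_mem_cutEdges {V : Type} {G : SimpleGraph V} {A : Set V} {u v : V} :
    s(u, v) ∈ cutEdges G A ↔ G.Adj u v ∧ ¬(u ∈ A ↔ v ∈ A) := by
  constructor
  · rintro ⟨he, a, b, hab, ha, hb⟩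
    refine ⟨he, ?_⟩
    rcases Sym2.eq_iff.1 hab with ⟨rfl, rfl⟩ | ⟨rfl, rfl⟩ <;> tauto
  · rintro ⟨he, h⟩
    by_cases hu : u ∈ A
    · exact ⟨he, u, v, rfl, hu, by tauto⟩
    · exact ⟨he, v, u, Sym2.eq_swap, by tauto, hu⟩

theorem cutEdges_nonempty {V : Type} {G : SimpleGraph V} (hG : G.Preconnected) {A : Set V}
    (hA : A.Nonempty) (hA' : Aᶜ.Nonempty) : (cutEdges G A).Nonempty := by
  obtain ⟨a, ha⟩ := hA
  obtain ⟨b, hb⟩ := hA'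
  obtain ⟨p⟩ := hG a b
  obtain ⟨d, -, hd, hd'⟩ := p.exists_boundary_dart A ha hb
  exact ⟨s(d.fst, d.snd), mk_mem_cutEdges.2 ⟨d.adj, by tauto⟩⟩

theorem pathEdges_isMatchingSet {n : ℕ} {S : Finset ℕ} (hS : ∀ i ∈ S, i + 1 ∉ S) :
    IsMatchingSet (SimpleGraph.pathGraph n) (pathEdges n S) := by
  refine ⟨?_, ?_⟩
  · rintro _ ⟨u, v, rfl, h, -⟩
    exact (SimpleGraph.mem_edgeSet _).2 (SimpleGraph.pathGraph_adj.2 (Or.inl h))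
  · rintro _ ⟨u, v, rfl, h, hu⟩ _ ⟨a, b, rfl, h', ha⟩ hne w ⟨hw, hw'⟩
    have h₁ : u.val + 1 ≠ a.val := fun h => hS _ hu (h ▸ ha)
    have h₂ : a.val + 1 ≠ u.val := fun h => hS _ ha (h ▸ hu)
    have h₃ : u.val ≠ a.val := fun hua => hne <| by
      rw [Fin.ext hua, (Fin.ext (by omega) : v = b)]
    rcases Sym2.mem_iff.1 hw with rfl | rfl <;> rcases Sym2.mem_iff.1 hw' with rfl | rfl <;> omega

/-- Every set of edges of a path graph is the cut whose side contains the vertices preceded by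
an even number of its edges. -/
theorem cutEdges_even_eq_pathEdges (n : ℕ) (S : Finset ℕ) :
    cutEdges (SimpleGraph.pathGraph n) {v | Even (S.filter (· < v.val)).card} =
      pathEdges n S := by
  have key : ∀ u v : Fin n, u.val + 1 = v.val →
      (s(u, v) ∈ cutEdges (SimpleGraph.pathGraph n) {v | Even (S.filter (· < v.val)).card} ↔
        u.val ∈ S) := by
    intro u v h
    rw [mk_mem_cutEdges]
    simp only [SimpleGraph.pathGraph_adj, h, true_or, true_and, Set.mem_ofPred_eq]
    rw [← h]
    by_cases hu : u.val ∈ S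
    · have : S.filter (· < u.val + 1) = insert u.val (S.filter (· < u.val)) := by
        ext i
        simp only [Finset.mem_filter, Finset.mem_insert]
        constructor
        · rintro ⟨hi, hlt⟩
          by_cases hiu : i = u.val
          · exact Or.inl hiu
          · exact Or.inr ⟨hi, by omega⟩
        · rintro (rfl | ⟨hi, hlt⟩)
          · exact ⟨hu, by omega⟩
          · exact ⟨hi, by omega⟩
      rw [this, Finset.card_insert_of_notMem (by simp), Nat.even_add_one]
      tauto
    · have : S.filter (· < u.val + 1) = S.filter (· < u.val) := by
        refine Finset.filter_congr fun i hi => ?_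
        have : i ≠ u.val := by rintro rfl; exact hu hi
        omega
      simp only [this, hu, not_true_eq_false]
  ext e
  constructor
  · intro he
    obtain ⟨u, v, rfl, h⟩ := exists_eq_mk_of_mem_edgeSet_pathGraph he.1
    exact (mk_mem_pathEdges h).2 ((key u v h).1 he)
  · rintro ⟨u, v, rfl, h, hu⟩
    exact (key u v h).2 hu

theorem pathEdges_isMatchingCut {m : ℕ} {S : Finset ℕ} (hS : S ∈ sparseSubsets m)
    (hne : S.Nonempty) :
    IsMatchingCut (SimpleGraph.pathGraph (m + 1)) (pathEdges (m + 1) S) := by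
  obtain ⟨hlt, hsp⟩ := mem_sparseSubsets.1 hS
  obtain ⟨i, hi⟩ := hne
  have him := hlt i hi
  have hmem : s((⟨i, by omega⟩ : Fin (m + 1)), ⟨i + 1, by omega⟩) ∈ pathEdges (m + 1) S :=
    (mk_mem_pathEdges rfl).2 hi
  rw [← cutEdges_even_eq_pathEdges] at hmem
  obtain ⟨-, u, v, -, hu, hv⟩ := hmem
  exact ⟨pathEdges_isMatchingSet hsp, _, ⟨u, hu⟩, ⟨v, hv⟩, (cutEdges_even_eq_pathEdges _ S).symm⟩

theorem IsMatchingCut.exists_eq_pathEdges {m : ℕ} {M : Set (Sym2 (Fin (m + 1)))}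
    (hM : IsMatchingCut (SimpleGraph.pathGraph (m + 1)) M) :
    ∃ S ∈ sparseSubsets m, S.Nonempty ∧ pathEdges (m + 1) S = M := by
  classical
  obtain ⟨⟨hsub, hmat⟩, A, hA, hA', hMA⟩ := hM
  let S : Finset ℕ := (Finset.range m).filter fun i =>
    ∃ u v : Fin (m + 1), u.val = i ∧ v.val = i + 1 ∧ s(u, v) ∈ M
  have hS : pathEdges (m + 1) S = M := by
    ext e
    constructor
    · rintro ⟨u, v, rfl, h, hu⟩
      obtain ⟨-, a, b, ha, hb, hab⟩ := Finset.mem_filter.1 hu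
      rwa [← (Fin.ext ha : a = u), ← (Fin.ext (by omega) : b = v)]
    · intro he
      obtain ⟨u, v, rfl, h⟩ := exists_eq_mk_of_mem_edgeSet_pathGraph (hsub he)
      exact ⟨u, v, rfl, h, Finset.mem_filter.2
        ⟨Finset.mem_range.2 (by omega), u, v, rfl, h.symm, he⟩⟩
  refine ⟨S, mem_sparseSubsets.2 ⟨fun i hi => ?_, fun i hi hi' => ?_⟩, ?_, hS⟩
  · exact Finset.mem_range.1 (Finset.mem_filter.1 hi).1
  · obtain ⟨-, u, v, hu, hv, huv⟩ := Finset.mem_filter.1 hi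
    obtain ⟨-, a, b, ha, hb, hab⟩ := Finset.mem_filter.1 hi'
    obtain rfl : v = a := Fin.ext (by omega)
    refine hmat _ huv _ hab (fun h => ?_) v ⟨Sym2.mem_mk_right _ _, Sym2.mem_mk_left _ _⟩
    rcases Sym2.eq_iff.1 h with ⟨rfl, -⟩ | ⟨rfl, -⟩ <;> omega
  · obtain ⟨e, he⟩ := cutEdges_nonempty (SimpleGraph.pathGraph_preconnected _) hA hA'
    rw [← hMA, ← hS] at he
    obtain ⟨u, -, -, -, hu⟩ := he
    exact ⟨_, hu⟩

/-- For every positive integer `n`, the path graph on `n` vertices has exactly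
`F(n + 1) - 1` matching cuts. -/
theorem pathGraph_card_matchingCuts (n : ℕ) (hn : 1 ≤ n) :
    Nat.card {M : Set (Sym2 (Fin n)) // IsMatchingCut (SimpleGraph.pathGraph n) M} =
      Nat.fib (n + 1) - 1 := by
  obtain ⟨m, rfl⟩ : ∃ m, n = m + 1 := ⟨n - 1, by omega⟩
  have himage : {M | IsMatchingCut (SimpleGraph.pathGraph (m + 1)) M} =
      pathEdges (m + 1) '' ((sparseSubsets m).erase ∅ : Finset (Finset ℕ)) := by
    ext M
    constructor
    · intro hM
      obtain ⟨S, hS, hne, rfl⟩ := IsMatchingCut.exists_eq_pathEdges hM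
      exact ⟨S, Finset.mem_coe.2 (Finset.mem_erase.2 ⟨hne.ne_empty, hS⟩), rfl⟩
    · rintro ⟨S, hS, rfl⟩
      obtain ⟨hne, hS⟩ := Finset.mem_erase.1 (Finset.mem_coe.1 hS)
      exact pathEdges_isMatchingCut hS (Finset.nonempty_iff_ne_empty.2 hne)
  have hinj : Set.InjOn (pathEdges (m + 1))
      ((sparseSubsets m).erase ∅ : Finset (Finset ℕ)) :=
    (pathEdges_injOn m).mono fun S hS =>
      (mem_sparseSubsets.1 (Finset.mem_of_mem_erase (Finset.mem_coe.1 hS))).1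
  change Nat.card {M | IsMatchingCut (SimpleGraph.pathGraph (m + 1)) M} = _
  rw [Nat.card_coe_set_eq, himage, hinj.ncard_image, Set.ncard_coe_finset,
    Finset.card_erase_of_mem (mem_sparseSubsets.2 (by simp)), card_sparseSubsets]

end MatchingCutPaper
end

section
/- Every forest on n vertices has at most F(n+1) − 1 nonempty matchings. -/
namespace MatchingCutPaper

theorem IsMatchingSet.mono_left {V : Type} {G : SimpleGraph V} {M N : Set (Sym2 V)}
    (hM : IsMatchingSet G M) (hN : N ⊆ M) : IsMatchingSet G N :=
  ⟨hN.trans hM.1, fun e he f hf => hM.2 e (hN he) f (hN hf)⟩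

theorem IsMatchingSet.deleteIncidenceSet {V : Type} {G : SimpleGraph V} {M : Set (Sym2 V)}
    (hM : IsMatchingSet G M) {v : V} (hv : ∀ e ∈ M, v ∉ e) :
    IsMatchingSet (G.deleteIncidenceSet v) M := by
  refine ⟨fun e he => ?_, hM.2⟩
  rw [SimpleGraph.edgeSet_deleteIncidenceSet]
  exact ⟨hM.1 he, fun h => hv e he h.2⟩

/-- A finite forest with an edge has a leaf. -/
theorem exists_leaf_of_isAcyclic {V : Type} [Finite V] {G : SimpleGraph V} (hG : G.IsAcyclic)
    (hne : G ≠ ⊥) : ∃ v u, G.Adj v u ∧ ∀ w, G.Adj v w → w = u := by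
  obtain ⟨a, b, hab⟩ := SimpleGraph.ne_bot_iff_exists_adj.mp hne
  have : Nonempty V := ⟨a⟩
  obtain ⟨v, z, p, hp, hmax⟩ := SimpleGraph.Walk.exists_isPath_forall_isPath_length_le_length G
  have hnil : ¬p.Nil := by
    intro h
    have h1 := hmax a b (SimpleGraph.Path.singleton hab).1 (SimpleGraph.Path.singleton hab).2
    rw [SimpleGraph.Walk.length_eq_zero_iff.mpr h] at h1
    simp [SimpleGraph.Path.singleton] at h1
  refine ⟨v, p.snd, p.adj_snd hnil, fun w hadj => hG.eq_snd_of_adj_start hp hadj ?_⟩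
  by_contra hw
  have h1 := hmax _ _ _ (hp.cons (h := hadj.symm) hw)
  simp at h1

/-- Matchings of `G` either avoid the leaf `v` or contain its edge `s(v, u)`. -/
theorem setOf_isMatchingSet_subset {V : Type} {G : SimpleGraph V} {v u : V}
    (hu : ∀ w, G.Adj v w → w = u) :
    {M | IsMatchingSet G M} ⊆ {M | IsMatchingSet (G.deleteIncidenceSet v) M} ∪
      insert s(v, u) '' {M | IsMatchingSet ((G.deleteIncidenceSet v).deleteIncidenceSet u) M} := by
  intro M hM
  change IsMatchingSet G M at hM
  by_cases he : s(v, u) ∈ M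
  · right
    have hdisj : ∀ x ∈ s(v, u), ∀ f ∈ M \ {s(v, u)}, x ∉ f := fun x hx f hf hxf =>
      hM.2 _ he f hf.1 (Ne.symm hf.2) x ⟨hx, hxf⟩
    refine ⟨M \ {s(v, u)}, ?_, by simp [Set.insert_eq_of_mem he]⟩
    exact ((hM.mono_left Set.sdiff_subset).deleteIncidenceSet (hdisj v (by simp))).deleteIncidenceSet
      (hdisj u (by simp))
  · left
    refine hM.deleteIncidenceSet fun e heM hve => he ?_
    obtain ⟨w, rfl⟩ := hve
    rwa [← hu w (hM.1 heM)]

theorem ncard_isMatchingSet_le_fib {V : Type} [Finite V] (k : ℕ) (G : SimpleGraph V)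
    (hG : G.IsAcyclic) (hk : G.support.ncard ≤ k) :
    {M | IsMatchingSet G M}.ncard ≤ Nat.fib (k + 1) := by
  induction k using Nat.strong_induction_on generalizing G with
  | _ k ih =>
    rcases eq_or_ne G ⊥ with rfl | hne
    · have hsub : {M | IsMatchingSet (⊥ : SimpleGraph V) M} ⊆ {∅} := fun M hM => by
        simpa using hM.1
      have h1 := Set.ncard_le_ncard hsub
      rw [Set.ncard_singleton] at h1
      exact h1.trans (Nat.fib_pos.mpr k.succ_pos)
    · obtain ⟨v, u, hvu, hu⟩ := exists_leaf_of_isAcyclic hG hne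
      have hv : v ∈ G.support := ⟨u, hvu⟩
      have huv : u ∈ G.support \ {v} := ⟨⟨v, hvu.symm⟩, hvu.ne'⟩
      have hs1 := G.support_deleteIncidenceSet_subset v
      have hs2 := ((G.deleteIncidenceSet v).support_deleteIncidenceSet_subset u).trans
        (Set.sdiff_subset_sdiff_left hs1)
      have hc1 := Set.ncard_le_ncard hs1
      have hc2 := Set.ncard_le_ncard hs2
      have hd1 := Set.ncard_sdiff_singleton_add_one hv
      have hd2 := Set.ncard_sdiff_singleton_add_one huv
      obtain ⟨j, rfl⟩ : ∃ j, k = j + 2 := ⟨k - 2, by lia⟩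
      have hG1 : (G.deleteIncidenceSet v).IsAcyclic := hG.anti (G.deleteIncidenceSet_le v)
      have hm1 := ih (j + 1) (by lia) _ hG1 (by lia)
      have hm2 := ih j (by lia) ((G.deleteIncidenceSet v).deleteIncidenceSet u)
        (hG1.anti (SimpleGraph.deleteIncidenceSet_le _ u)) (by lia)
      calc _ ≤ _ := Set.ncard_le_ncard (setOf_isMatchingSet_subset hu)
        _ ≤ _ := Set.ncard_union_le _ _
        _ ≤ Nat.fib (j + 1 + 1) + Nat.fib (j + 1) :=
          add_le_add hm1 ((Set.ncard_image_le).trans hm2)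
        _ = Nat.fib (j + 2 + 1) := by rw [Nat.fib_add_two (n := j + 1), add_comm]

/-- Every forest on `n` vertices has at most `F(n + 1) - 1` nonempty matchings. -/
theorem forest_card_nonempty_matchings_le {V : Type} [Fintype V] (n : ℕ)
    (F : SimpleGraph V) (hacyc : F.IsAcyclic) (hcard : Fintype.card V = n) :
    Nat.card {M : Set (Sym2 V) // M.Nonempty ∧ IsMatchingSet F M} ≤ Nat.fib (n + 1) - 1 := by
  have hset : {M : Set (Sym2 V) | M.Nonempty ∧ IsMatchingSet F M} =
      {M | IsMatchingSet F M} \ {∅} := by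
    ext M
    simp [Set.nonempty_iff_ne_empty, and_comm]
  have hempty : ∅ ∈ {M | IsMatchingSet F M} := ⟨Set.empty_subset _, by simp⟩
  have hsupp : F.support.ncard ≤ n :=
    (Set.ncard_le_card _).trans (by rw [Nat.card_eq_fintype_card, hcard])
  change Nat.card {M : Set (Sym2 V) | M.Nonempty ∧ IsMatchingSet F M} ≤ _
  rw [Nat.card_coe_set_eq, hset, Set.ncard_sdiff_singleton_of_mem hempty]
  exact Nat.sub_le_sub_right (ncard_isMatchingSet_le_fib n F hacyc hsupp) 1

end MatchingCutPaper
end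

section
/- If H is a forest on n vertices that is not isomorphic to the path graph P_n on n vertices, then the number of nonempty matchings of H is strictly less than F(n+1) − 1. -/
namespace MatchingCutPaper

lemma exists_forall_adj_eq {V : Type} [Finite V] [Nonempty V] {G : SimpleGraph V}
    (hG : G.IsAcyclic) : ∃ v, ∀ u w, G.Adj v u → G.Adj v w → u = w := by
  classical
  have := Fintype.ofFinite V
  rcases subsingleton_or_nontrivial V with _ | _
  · exact ⟨Classical.arbitrary V, fun u w _ _ ↦ Subsingleton.elim u w⟩
  · obtain ⟨T, hGT, -, hT⟩ :=
      SimpleGraph.connected_top.exists_isTree_le_of_le_of_isAcyclic (le_top : G ≤ ⊤) hG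
    obtain ⟨v, hv⟩ := hT.exists_vert_degree_one_of_nontrivial
    obtain ⟨x, -, hx⟩ := SimpleGraph.degree_eq_one_iff_existsUnique_adj.mp hv
    exact ⟨v, fun u w hu hw ↦ (hx u (hGT hu)).trans (hx w (hGT hw)).symm⟩

lemma exists_mem_forall_adj_eq {V : Type} {G : SimpleGraph V} (hG : G.IsAcyclic)
    {S : Finset V} (hS : S.Nonempty) :
    ∃ v ∈ S, ∀ u ∈ S, ∀ w ∈ S, G.Adj v u → G.Adj v w → u = w := by
  have : Nonempty (S : Set V) := hS.to_subtype
  obtain ⟨v, hv⟩ := exists_forall_adj_eq (hG.induce (S : Set V))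
  exact ⟨v, v.2, fun u hu w hw h h' ↦ congrArg Subtype.val (hv ⟨u, hu⟩ ⟨w, hw⟩ h h')⟩

/-- The matchings of `G` all of whose edges have both endpoints in `S`. -/
def matchingsWithin {V : Type} (G : SimpleGraph V) (S : Finset V) : Set (Set (Sym2 V)) :=
  {M | IsMatchingSet G M ∧ ∀ e ∈ M, ∀ v ∈ e, v ∈ S}

/-- The vertices in `S` can be numbered `0, …, |S| - 1` so that adjacency in `G` is the relation
of having consecutive numbers. -/
def InducesPath {V : Type} (G : SimpleGraph V) (S : Finset V) : Prop :=
  ∃ g : V → ℕ, (∀ x ∈ S, g x < S.card) ∧ Set.InjOn g S ∧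
    ∀ x ∈ S, ∀ y ∈ S, G.Adj x y ↔ g x + 1 = g y ∨ g y + 1 = g x

lemma matchingsWithin_subset_of_isolated {V : Type} [DecidableEq V] {G : SimpleGraph V}
    {S : Finset V} {v : V} (hv : ∀ u ∈ S, ¬ G.Adj v u) :
    matchingsWithin G S ⊆ matchingsWithin G (S.erase v) := by
  rintro M ⟨hM, hMS⟩
  refine ⟨hM, fun e he x hx ↦ Finset.mem_erase.mpr ⟨?_, hMS e he x hx⟩⟩
  rintro rfl
  obtain ⟨y, rfl⟩ := Sym2.mem_iff_exists.mp hx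
  exact hv y (hMS _ he y (Sym2.mem_mk_right x y)) (hM.1 he)

lemma matchingsWithin_subset_of_leaf {V : Type} [DecidableEq V] {G : SimpleGraph V}
    {S : Finset V} {u v : V} (hv : ∀ w ∈ S, G.Adj v w → w = u) :
    matchingsWithin G S ⊆ matchingsWithin G (S.erase v) ∪
      insert s(v, u) '' matchingsWithin G ((S.erase v).erase u) := by
  rintro M ⟨hM, hMS⟩
  by_cases h : s(v, u) ∈ M
  · refine Or.inr ⟨M \ {s(v, u)}, ⟨⟨Set.sdiff_subset.trans hM.1, fun e he f hf ↦
      hM.2 e he.1 f hf.1⟩, fun e he x hx ↦ ?_⟩, Set.insert_sdiff_singleton.trans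
        (Set.insert_eq_of_mem h)⟩
    have hdisj := hM.2 e he.1 _ h he.2 x
    have hxS := hMS e he.1 x hx
    simp only [hx, Sym2.mem_iff, true_and, not_or] at hdisj
    simp [hdisj, hxS]
  · refine Or.inl ⟨hM, fun e he x hx ↦ Finset.mem_erase.mpr ⟨?_, hMS e he x hx⟩⟩
    rintro rfl
    obtain ⟨y, rfl⟩ := Sym2.mem_iff_exists.mp hx
    exact h (hv y (hMS _ he y (Sym2.mem_mk_right x y)) (hM.1 he) ▸ he)

lemma exists_mem_eq_of_injOn {V : Type} {S : Finset V} {g : V → ℕ}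
    (hlt : ∀ x ∈ S, g x < S.card) (hinj : Set.InjOn g S) {i : ℕ} (hi : i < S.card) :
    ∃ x ∈ S, g x = i := by
  have himg : S.image g = Finset.range S.card :=
    Finset.eq_of_subset_of_card_le
      (fun i hi ↦ by
        obtain ⟨x, hx, rfl⟩ := Finset.mem_image.mp hi
        exact Finset.mem_range.mpr (hlt x hx))
      (by rw [Finset.card_range, Finset.card_image_of_injOn hinj])
  exact Finset.mem_image.mp (himg ▸ Finset.mem_range.mpr hi)

/-- A vertex set inducing a path is not split by a partition that no edge crosses. -/
lemma InducesPath.forall_iff {V : Type} {G : SimpleGraph V} {S : Finset V}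
    (h : InducesPath G S) {p : V → Prop}
    (hp : ∀ x ∈ S, ∀ y ∈ S, G.Adj x y → (p x ↔ p y)) :
    ∀ x ∈ S, ∀ y ∈ S, (p x ↔ p y) := by
  obtain ⟨g, hlt, hinj, hadj⟩ := h
  have key : ∀ i, ∀ x ∈ S, ∀ y ∈ S, g x = 0 → g y = i → (p x ↔ p y) := by
    intro i
    induction i with
    | zero => intro x hx y hy h0 h1; rw [hinj hx hy (h0.trans h1.symm)]
    | succ i ih =>
      intro x hx y hy h0 h1
      obtain ⟨z, hz, hzi⟩ := exists_mem_eq_of_injOn hlt hinj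
        (show i < S.card by have := hlt y hy; omega)
      exact (ih x hx z hz h0 hzi).trans (hp z hz y hy ((hadj z hz y hy).mpr (by omega)))
  intro x hx y hy
  obtain ⟨z, hz, hz0⟩ := exists_mem_eq_of_injOn hlt hinj
    (Finset.card_pos.mpr ⟨x, hx⟩)
  exact (key _ z hz x hx hz0 rfl).symm.trans (key _ z hz y hy hz0 rfl)

lemma InducesPath.of_leaf {V : Type} [DecidableEq V] {G : SimpleGraph V} {S : Finset V}
    {u v : V} (hvS : v ∈ S) (huS : u ∈ S) (hvu : G.Adj v u)
    (hv : ∀ w ∈ S, G.Adj v w → w = u) (h₁ : InducesPath G (S.erase v))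
    (h₂ : InducesPath G ((S.erase v).erase u)) : InducesPath G S := by
  obtain ⟨g, hlt, hinj, hadj⟩ := h₁
  have hu : u ∈ S.erase v := Finset.mem_erase.mpr ⟨hvu.ne', huS⟩
  have hcard : (S.erase v).card + 1 = S.card := Finset.card_erase_add_one hvS
  have hadj_v : ∀ w ∈ S, G.Adj v w ↔ w = u := fun w hw ↦ ⟨hv w hw, fun h ↦ h ▸ hvu⟩
  have hend : g u = 0 ∨ g u + 1 = (S.erase v).card := by
    by_contra! hne
    have hult := hlt u hu
    obtain ⟨x, hx, hxu⟩ := exists_mem_eq_of_injOn hlt hinj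
      (show g u - 1 < (S.erase v).card by omega)
    obtain ⟨y, hy, hyu⟩ := exists_mem_eq_of_injOn hlt hinj
      (show g u + 1 < (S.erase v).card by omega)
    have hside := h₂.forall_iff (p := fun z ↦ g z < g u) (fun a ha b hb hab ↦ by
      obtain ⟨hau, ha⟩ := Finset.mem_erase.mp ha
      obtain ⟨hbu, hb⟩ := Finset.mem_erase.mp hb
      have h1 := (hadj a ha b hb).mp hab
      have h2 : g a ≠ g u := fun h ↦ hau (hinj ha hu h)
      have h3 : g b ≠ g u := fun h ↦ hbu (hinj hb hu h)
      omega)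
      x (Finset.mem_erase.mpr ⟨by rintro rfl; omega, hx⟩)
      y (Finset.mem_erase.mpr ⟨by rintro rfl; omega, hy⟩)
    omega
  have hmem : ∀ x ∈ S, x ≠ v → x ∈ S.erase v := fun x hx hxv ↦ Finset.mem_erase.mpr ⟨hxv, hx⟩
  have hgu : ∀ x ∈ S, x ≠ v → (x = u ↔ g x = g u) := fun x hx hxv ↦
    ⟨fun h ↦ h ▸ rfl, fun h ↦ hinj (hmem x hx hxv) hu h⟩
  rcases hend with h0 | htop
  · refine ⟨fun x ↦ if x = v then 0 else g x + 1, fun x hx ↦ ?_, fun x hx y hy hxy ↦ ?_,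
      fun x hx y hy ↦ ?_⟩
    · grind
    · have := @hinj x
      grind
    · by_cases hxv : x = v <;> by_cases hyv : y = v
      · subst hxv hyv; simp
      · subst hxv; rw [hadj_v y hy, hgu y hy hyv]; simp [hyv, h0]
      · subst hyv; rw [G.adj_comm, hadj_v x hx, hgu x hx hxv]; simp [hxv, h0]
      · rw [hadj x (hmem x hx hxv) y (hmem y hy hyv)]; simp [hxv, hyv]
  · refine ⟨fun x ↦ if x = v then (S.erase v).card else g x, fun x hx ↦ ?_,
      fun x hx y hy hxy ↦ ?_, fun x hx y hy ↦ ?_⟩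
    · grind
    · have := @hinj x
      grind
    · by_cases hxv : x = v <;> by_cases hyv : y = v
      · subst hxv hyv; simp
      · have := hlt y (hmem y hy hyv)
        subst hxv; rw [hadj_v y hy, hgu y hy hyv]; simp only [hyv, if_true, if_false]; omega
      · have := hlt x (hmem x hx hxv)
        subst hyv; rw [G.adj_comm, hadj_v x hx, hgu x hx hxv]
        simp only [hxv, if_true, if_false]; omega
      · rw [hadj x (hmem x hx hxv) y (hmem y hy hyv)]; simp [hxv, hyv]

lemma InducesPath.nonempty_iso {V : Type} [Fintype V] {G : SimpleGraph V}
    (h : InducesPath G Finset.univ) :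
    Nonempty (G ≃g SimpleGraph.pathGraph (Fintype.card V)) := by
  obtain ⟨g, hlt, hinj, hadj⟩ := h
  let f : V → Fin (Fintype.card V) := fun x ↦ ⟨g x, hlt x (Finset.mem_univ x)⟩
  have hf : Function.Injective f := fun x y hxy ↦
    hinj (by simp) (by simp) (congrArg Fin.val hxy)
  have hbij : Function.Bijective f :=
    (Fintype.bijective_iff_injective_and_card f).mpr ⟨hf, (Fintype.card_fin _).symm⟩
  refine ⟨⟨Equiv.ofBijective f hbij, fun {x y} ↦ ?_⟩⟩
  rw [SimpleGraph.pathGraph_adj, hadj x (Finset.mem_univ x) y (Finset.mem_univ y)]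
  rfl

theorem ncard_matchingsWithin_le {V : Type} [Finite V] {G : SimpleGraph V}
    (hG : G.IsAcyclic) (S : Finset V) :
    (matchingsWithin G S).ncard ≤ Nat.fib (S.card + 1) ∧
      ((matchingsWithin G S).ncard = Nat.fib (S.card + 1) → InducesPath G S) := by
  classical
  induction S using Finset.strongInduction with
  | H S ih =>
  rcases S.eq_empty_or_nonempty with rfl | hS
  · refine ⟨?_, fun _ ↦ ⟨fun _ ↦ 0, by simp, by simp, by simp⟩⟩
    have : matchingsWithin G ∅ ⊆ {∅} := by
      rintro M ⟨-, hM⟩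
      refine Set.eq_empty_of_forall_notMem fun e he ↦ ?_
      induction e with
      | h x y => exact Finset.notMem_empty x (hM _ he x (Sym2.mem_mk_left x y))
    simpa using Set.ncard_le_ncard this
  obtain ⟨v, hvS, hv⟩ := exists_mem_forall_adj_eq hG hS
  have hcard := Finset.card_erase_add_one hvS
  have h₁ := ih _ (Finset.erase_ssubset hvS)
  by_cases hu : ∃ u ∈ S, G.Adj v u
  · obtain ⟨u, huS, hvu⟩ := hu
    have huS' : u ∈ S.erase v := Finset.mem_erase.mpr ⟨hvu.ne', huS⟩
    have hleaf : ∀ w ∈ S, G.Adj v w → w = u := fun w hw h ↦ hv w hw u huS h hvu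
    have hcard' := Finset.card_erase_add_one huS'
    have h₂ := ih _ ((Finset.erase_ssubset huS').trans (Finset.erase_ssubset hvS))
    have hle := ((Set.ncard_le_ncard (matchingsWithin_subset_of_leaf hleaf)).trans
      (Set.ncard_union_le _ _)).trans (Nat.add_le_add_left (Set.ncard_image_le) _)
    have hfib : Nat.fib (S.card + 1) = Nat.fib ((S.erase v).card + 1) +
        Nat.fib (((S.erase v).erase u).card + 1) := by
      rw [← hcard, ← hcard', Nat.fib_add_two, add_comm]
    have h₁le := h₁.1
    have h₂le := h₂.1
    exact ⟨by omega, fun h ↦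
      .of_leaf hvS huS hvu hleaf (h₁.2 (by omega)) (h₂.2 (by omega))⟩
  · push Not at hu
    have hle := (Set.ncard_le_ncard (matchingsWithin_subset_of_isolated hu)).trans h₁.1
    rw [hcard] at hle
    refine ⟨hle.trans Nat.fib_le_fib_succ, fun h ↦ ?_⟩
    have hone : S.card = 1 := by
      by_contra hne
      have := Nat.fib_lt_fib_succ (n := S.card) (by omega)
      omega
    obtain ⟨w, rfl⟩ := Finset.card_eq_one.mp hone
    exact ⟨fun _ ↦ 0, by simp, by simp, by simp⟩

/-- If `H` is a forest on `n` vertices that is not isomorphic to the path graph `P_n` on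
`n` vertices, then the number of nonempty matchings of `H` is strictly less than
`F(n + 1) - 1`. -/
theorem forest_card_nonempty_matchings_lt {V : Type} [Fintype V] (n : ℕ)
    (H : SimpleGraph V) (hacyc : H.IsAcyclic) (hcard : Fintype.card V = n)
    (hnotpath : ¬ Nonempty (H ≃g SimpleGraph.pathGraph n)) :
    Nat.card {M : Set (Sym2 V) // M.Nonempty ∧ IsMatchingSet H M} < Nat.fib (n + 1) - 1 := by
  subst hcard
  have hle := ncard_matchingsWithin_le hacyc Finset.univ
  rw [Finset.card_univ] at hle
  have hlt := hle.1.lt_of_ne fun h ↦ hnotpath (hle.2 h).nonempty_iso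
  have hinsert : matchingsWithin H Finset.univ =
      insert ∅ {M : Set (Sym2 V) | M.Nonempty ∧ IsMatchingSet H M} := by
    ext M
    rcases M.eq_empty_or_nonempty with rfl | hM
    · simp [matchingsWithin, IsMatchingSet]
    · simp [matchingsWithin, hM, hM.ne_empty]
  rw [hinsert, Set.ncard_insert_of_notMem (by simp)] at hlt
  exact Nat.lt_sub_of_add_lt hlt

end MatchingCutPaper
end

section
/- Let G be a graph whose connected components are G_1, …, G_k (k ≥ 2) and suppose each G_i has at least one matching cut. Then a set M of edges of G is a maximal matching cut of G if and only if M = M_1 ∪ … ∪ M_k where, for every i ∈ {1, …, k}, M_i is a maximal matching cut of G_i. -/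
namespace MatchingCutPaper

/-- The part of an edge set of `G` lying inside the component `c`. -/
def restrictEdges {V : Type} {G : SimpleGraph V} (c : G.ConnectedComponent)
    (M : Set (Sym2 V)) : Set (Sym2 ↥(c.supp)) :=
  Sym2.map (fun x : ↥(c.supp) => (x : V)) ⁻¹' M

/-- The union of edge sets given on all the components of `G`. -/
def unionEdges {V : Type} {G : SimpleGraph V}
    (f : (c : G.ConnectedComponent) → Set (Sym2 ↥(c.supp))) : Set (Sym2 V) :=
  ⋃ c : G.ConnectedComponent, (Sym2.map (fun x : ↥(c.supp) => (x : V))) '' (f c)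

section

variable {V : Type} {G : SimpleGraph V}

theorem map_val_injective (c : G.ConnectedComponent) :
    Function.Injective (Sym2.map (fun x : ↥(c.supp) => (x : V))) :=
  Sym2.map.injective Subtype.val_injective

theorem mem_supp_of_mem_map {c : G.ConnectedComponent} {e : Sym2 ↥(c.supp)} {v : V}
    (h : v ∈ e.map (fun x : ↥(c.supp) => (x : V))) : ∃ hv : v ∈ c.supp, ⟨v, hv⟩ ∈ e := by
  obtain ⟨x, hx, rfl⟩ := Sym2.mem_map.1 h
  exact ⟨x.2, hx⟩

theorem component_eq_of_mem_map {c d : G.ConnectedComponent} {e : Sym2 ↥(c.supp)}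
    {f : Sym2 ↥(d.supp)} {v : V} (he : v ∈ e.map (fun x : ↥(c.supp) => (x : V)))
    (hf : v ∈ f.map (fun x : ↥(d.supp) => (x : V))) : c = d := by
  obtain ⟨hc, -⟩ := mem_supp_of_mem_map he
  obtain ⟨hd, -⟩ := mem_supp_of_mem_map hf
  exact hc.symm.trans hd

theorem exists_map_eq_of_mem_edgeSet {e : Sym2 V} (he : e ∈ G.edgeSet) :
    ∃ (c : G.ConnectedComponent) (e' : Sym2 ↥(c.supp)),
      e'.map (fun x : ↥(c.supp) => (x : V)) = e := by
  induction e using Sym2.ind with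
  | _ u v =>
    have huv : G.Adj u v := he
    exact ⟨G.connectedComponentMk u,
      s(⟨u, rfl⟩, ⟨v, SimpleGraph.ConnectedComponent.sound huv.symm.reachable⟩), rfl⟩

theorem map_mem_edgeSet {c : G.ConnectedComponent} {e : Sym2 ↥(c.supp)} :
    e.map (fun x : ↥(c.supp) => (x : V)) ∈ G.edgeSet ↔ e ∈ (G.induce c.supp).edgeSet := by
  induction e using Sym2.ind with
  | _ u v => simp

theorem map_mem_unionEdges {f : (c : G.ConnectedComponent) → Set (Sym2 ↥(c.supp))}
    {c : G.ConnectedComponent} {e : Sym2 ↥(c.supp)} :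
    e.map (fun x : ↥(c.supp) => (x : V)) ∈ unionEdges f ↔ e ∈ f c := by
  constructor
  · intro h
    obtain ⟨d, e', he', heq⟩ := Set.mem_iUnion.1 h
    induction e using Sym2.ind with
    | _ u v =>
      have hu : (u : V) ∈ s(u, v).map (fun x : ↥(c.supp) => (x : V)) := by simp
      obtain rfl : d = c := component_eq_of_mem_map (heq ▸ hu) hu
      rwa [map_val_injective d heq] at he'
  · exact fun h => Set.mem_iUnion.2 ⟨c, e, h, rfl⟩

theorem restrictEdges_unionEdges (f : (c : G.ConnectedComponent) → Set (Sym2 ↥(c.supp)))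
    (c : G.ConnectedComponent) : restrictEdges c (unionEdges f) = f c :=
  Set.ext fun _ => map_mem_unionEdges

theorem subset_unionEdges {M : Set (Sym2 V)} (hM : M ⊆ G.edgeSet)
    {f : (c : G.ConnectedComponent) → Set (Sym2 ↥(c.supp))}
    (h : ∀ c, restrictEdges c M ⊆ f c) : M ⊆ unionEdges f := by
  intro e he
  obtain ⟨c, e', rfl⟩ := exists_map_eq_of_mem_edgeSet (hM he)
  exact map_mem_unionEdges.2 (h c he)

theorem restrictEdges_cutEdges (c : G.ConnectedComponent) (A : Set V) :
    restrictEdges c (cutEdges G A) = cutEdges (G.induce c.supp) (Subtype.val ⁻¹' A) := by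
  ext e
  refine and_congr map_mem_edgeSet ?_
  constructor
  · rintro ⟨u, v, huv, hu, hv⟩
    obtain ⟨hcu, -⟩ := mem_supp_of_mem_map (huv ▸ Sym2.mem_mk_left u v)
    obtain ⟨hcv, -⟩ := mem_supp_of_mem_map (huv ▸ Sym2.mem_mk_right u v)
    exact ⟨⟨u, hcu⟩, ⟨v, hcv⟩, map_val_injective c huv, hu, hv⟩
  · rintro ⟨u, v, rfl, hu, hv⟩
    exact ⟨u, v, rfl, hu, hv⟩

theorem IsMatchingSet.restrictEdges {M : Set (Sym2 V)} (hM : IsMatchingSet G M)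
    (c : G.ConnectedComponent) :
    IsMatchingSet (G.induce c.supp) (restrictEdges c M) :=
  ⟨fun _ he => map_mem_edgeSet.1 (hM.1 he), fun _ he _ hf hne v hv =>
    hM.2 _ he _ hf ((map_val_injective c).ne hne) v
      ⟨Sym2.mem_map.2 ⟨v, hv.1, rfl⟩, Sym2.mem_map.2 ⟨v, hv.2, rfl⟩⟩⟩

theorem IsMatchingSet.unionEdges {f : (c : G.ConnectedComponent) → Set (Sym2 ↥(c.supp))}
    (hf : ∀ c, IsMatchingSet (G.induce c.supp) (f c)) : IsMatchingSet G (unionEdges f) := by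
  refine ⟨Set.iUnion_subset ?_, ?_⟩
  · rintro c _ ⟨e, he, rfl⟩
    exact map_mem_edgeSet.2 ((hf c).1 he)
  · intro e he e' he' hne v ⟨hv, hv'⟩
    obtain ⟨c, a, ha, rfl⟩ := Set.mem_iUnion.1 he
    obtain ⟨d, b, hb, rfl⟩ := Set.mem_iUnion.1 he'
    obtain rfl := component_eq_of_mem_map hv hv'
    obtain ⟨_, hw⟩ := mem_supp_of_mem_map hv
    obtain ⟨_, hz⟩ := mem_supp_of_mem_map hv'
    exact (hf c).2 a ha b hb (fun h => hne (h ▸ rfl)) _ ⟨hw, hz⟩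

/-- The restriction of a matching cut to a component is a matching cut, unless it is empty. -/
theorem IsMatchingCut.restrictEdges {M : Set (Sym2 V)} (hM : IsMatchingCut G M)
    {c : G.ConnectedComponent} (hne : (restrictEdges c M).Nonempty) :
    IsMatchingCut (G.induce c.supp) (restrictEdges c M) := by
  refine ⟨hM.1.restrictEdges c, ?_⟩
  obtain ⟨-, A, -, -, rfl⟩ := hM
  rw [restrictEdges_cutEdges] at hne ⊢
  obtain ⟨e, -, u, v, -, hu, hv⟩ := hne
  exact ⟨_, ⟨u, hu⟩, ⟨v, hv⟩, rfl⟩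

theorem IsMatchingCut.unionEdges [Nonempty G.ConnectedComponent]
    {f : (c : G.ConnectedComponent) → Set (Sym2 ↥(c.supp))}
    (hf : ∀ c, IsMatchingCut (G.induce c.supp) (f c)) : IsMatchingCut G (unionEdges f) := by
  have hset := IsMatchingSet.unionEdges fun c => (hf c).1
  refine ⟨hset, ?_⟩
  choose A hA hA' hfA using fun c => (hf c).2
  let B : Set V := {v | ⟨v, rfl⟩ ∈ A (G.connectedComponentMk v)}
  have hB : ∀ c : G.ConnectedComponent, (Subtype.val ⁻¹' B : Set ↥(c.supp)) = A c := by
    intro c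
    ext ⟨v, hv⟩
    obtain rfl : G.connectedComponentMk v = c := hv
    rfl
  obtain ⟨c⟩ := ‹Nonempty G.ConnectedComponent›
  obtain ⟨u, hu⟩ := hA c
  obtain ⟨v, hv⟩ := hA' c
  rw [← hB c] at hu hv
  refine ⟨B, ⟨u, hu⟩, ⟨v, hv⟩, ?_⟩
  have hres : ∀ d, MatchingCutPaper.restrictEdges d (cutEdges G B) = f d := fun d => by
    rw [restrictEdges_cutEdges, hB, hfA]
  apply Set.Subset.antisymm
  · refine Set.iUnion_subset fun d => ?_
    rw [← hres d]
    exact Set.image_preimage_subset _ _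
  · exact subset_unionEdges (fun e he => he.1) fun d => (hres d).subset

end

/-- Let `G` be a graph with `k ≥ 2` connected components, each of which has at least one
matching cut.  Then a set `M` of edges of `G` is a maximal matching cut of `G` if and only
if `M` is the union, over all connected components `c`, of (the images in `G` of) maximal
matching cuts of the subgraphs induced by the components. -/
theorem isMaximalMatchingCut_iff_components {V : Type} [Fintype V] (G : SimpleGraph V)
    (hk : 2 ≤ Nat.card G.ConnectedComponent)
    (hall : ∀ c : G.ConnectedComponent,
      ∃ N : Set (Sym2 ↥(c.supp)), IsMatchingCut (G.induce c.supp) N)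
    (M : Set (Sym2 V)) :
    IsMaximalMatchingCut G M ↔
      ∃ f : (c : G.ConnectedComponent) → Set (Sym2 ↥(c.supp)),
        (∀ c, IsMaximalMatchingCut (G.induce c.supp) (f c)) ∧
        M = ⋃ c : G.ConnectedComponent,
              (Sym2.map (fun x : ↥(c.supp) => (x : V))) '' (f c) := by
  classical
  have hpos : 0 < Nat.card G.ConnectedComponent := by omega
  have : Nonempty G.ConnectedComponent := (Nat.card_pos_iff.1 hpos).1
  constructor
  · rintro ⟨hM, hmax⟩
    have hext : ∀ f : (c : G.ConnectedComponent) → Set (Sym2 ↥(c.supp)),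
        (∀ c, IsMatchingCut (G.induce c.supp) (f c)) → (∀ c, restrictEdges c M ⊆ f c) →
        M = unionEdges f := by
      intro f hf hsub
      by_contra hne
      exact hmax _ ((subset_unionEdges hM.1.1 hsub).ssubset_of_ne hne)
        (IsMatchingCut.unionEdges hf)
    choose N hN using hall
    have hMN := hext (fun c => if (restrictEdges c M).Nonempty then restrictEdges c M else N c)
      (fun c => by
        split_ifs with h
        · exact hM.restrictEdges h
        · exact hN c)
      (fun c => by
        split_ifs with h
        · exact subset_rfl
        · simp [Set.not_nonempty_iff_eq_empty.1 h])
    have hcut : ∀ c : G.ConnectedComponent,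
        IsMatchingCut (G.induce c.supp) (restrictEdges c M) := by
      intro c
      by_cases h : (restrictEdges c M).Nonempty
      · exact hM.restrictEdges h
      · have hc := congrArg (restrictEdges c) hMN
        rw [restrictEdges_unionEdges, if_neg h] at hc
        exact hc ▸ hN c
    refine ⟨fun c => restrictEdges c M, fun c => ⟨hcut c, fun M' hM' hM'cut => ?_⟩,
      hext _ hcut fun _ => subset_rfl⟩
    have hupd := hext (Function.update (fun d => restrictEdges d M) c M')
      (fun d => by
        rcases eq_or_ne d c with rfl | hd
        · simpa using hM'cut
        · simpa [hd] using hcut d)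
      (fun d => by
        rcases eq_or_ne d c with rfl | hd
        · simpa using hM'.subset
        · simp [hd])
    have hc := congrArg (restrictEdges c) hupd
    rw [restrictEdges_unionEdges, Function.update_self] at hc
    exact hM'.ne hc
  · rintro ⟨f, hf, rfl⟩
    change IsMaximalMatchingCut G (unionEdges f)
    refine ⟨IsMatchingCut.unionEdges fun c => (hf c).1, fun M' hM' hcut => ?_⟩
    obtain ⟨e, he, hne⟩ := Set.exists_of_ssubset hM'
    obtain ⟨c, e, rfl⟩ := exists_map_eq_of_mem_edgeSet (hcut.1.1 he)
    have hsub : f c ⊆ restrictEdges c M' := fun e' he' =>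
      hM'.subset (map_mem_unionEdges.2 he')
    exact (hf c).2 _ ⟨hsub, fun h => hne (map_mem_unionEdges.2 (h he))⟩
      (hcut.restrictEdges ⟨e, he⟩)

end MatchingCutPaper
end

section
/- For every positive integer k, there exists a graph on exactly 5k vertices that has at least 4^k minimal matching cuts. -/
namespace MatchingCutPaper

/-- The graph made of `k` paths `(i, 0), …, (i, 4)` of length `4`, in which the vertices `(i, 0)`
form a clique and the vertices `(i, 4)` form a clique. -/
def pathsBetweenCliques (k : ℕ) : SimpleGraph (Fin k × Fin 5) where
  Adj x y := (x.1 = y.1 ∧ (x.2.val + 1 = y.2.val ∨ y.2.val + 1 = x.2.val)) ∨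
    (x.1 ≠ y.1 ∧ x.2 = y.2 ∧ (x.2 = 0 ∨ x.2 = 4))
  symm := ⟨fun x y h ↦ by grind⟩
  loopless := ⟨fun x h ↦ by grind⟩

/-- The `a`-th edge of the `i`-th path. -/
def pathEdge {k : ℕ} (i : Fin k) (a : Fin 4) : Sym2 (Fin k × Fin 5) :=
  s((i, a.castSucc), (i, a.succ))

theorem adj_castSucc_succ {k : ℕ} (i : Fin k) (a : Fin 4) :
    (pathsBetweenCliques k).Adj (i, a.castSucc) (i, a.succ) := by
  simp [pathsBetweenCliques]

theorem adj_ends {k : ℕ} {i j : Fin k} (hij : i ≠ j) {a : Fin 5} (ha : a = 0 ∨ a = 4) :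
    (pathsBetweenCliques k).Adj (i, a) (j, a) :=
  Or.inr ⟨hij, rfl, ha⟩

theorem pathEdge_inj {k : ℕ} {i j : Fin k} {a b : Fin 4} :
    pathEdge i a = pathEdge j b ↔ i = j ∧ a = b := by
  simp only [pathEdge, Sym2.eq_iff, Prod.mk.injEq, Fin.ext_iff, Fin.val_castSucc, Fin.val_succ]
  omega

theorem fst_eq_of_mem_pathEdge {k : ℕ} {i : Fin k} {a : Fin 4} {x : Fin k × Fin 5}
    (hx : x ∈ pathEdge i a) : x.1 = i := by
  rcases Sym2.mem_iff.1 hx with rfl | rfl <;> rfl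

theorem mk_ne_pathEdge {k : ℕ} {i j l : Fin k} (hij : i ≠ j) (a b : Fin 5) (c : Fin 4) :
    s((i, a), (j, b)) ≠ pathEdge l c := fun h ↦
  hij ((fst_eq_of_mem_pathEdge (h ▸ Sym2.mem_mk_left _ _)).trans
    (fst_eq_of_mem_pathEdge (h ▸ Sym2.mem_mk_right (i, a) (j, b))).symm)

theorem mem_iff_mem_of_notMem_cutEdges {V : Type} {G : SimpleGraph V} {A : Set V} {x y : V}
    (hxy : G.Adj x y) (h : s(x, y) ∉ cutEdges G A) : x ∈ A ↔ y ∈ A := by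
  by_contra hne
  by_cases hx : x ∈ A
  · exact h ⟨hxy, x, y, rfl, hx, fun hy ↦ hne (iff_of_true hx hy)⟩
  · exact h ⟨hxy, y, x, Sym2.eq_swap, by_contra fun hy ↦ hne (iff_of_false hx hy), hx⟩

theorem range_pathEdge_eq_cutEdges {k : ℕ} (f : Fin k → Fin 4) :
    Set.range (fun i ↦ pathEdge i (f i)) =
      cutEdges (pathsBetweenCliques k) {x | x.2 ≤ (f x.1).castSucc} := by
  ext e
  constructor
  · rintro ⟨i, rfl⟩
    exact ⟨adj_castSucc_succ i (f i), _, _, rfl, by simp, by simp [Fin.le_def]⟩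
  · rintro ⟨he, ⟨i, a⟩, ⟨j, b⟩, rfl, ha, hb⟩
    have hf := (f i).isLt
    have hf' := (f j).isLt
    simp only [Set.mem_ofPred_eq, Fin.le_def, Fin.val_castSucc, not_le] at ha hb
    rcases he with ⟨hij, hab⟩ | ⟨-, hab, h0 | h4⟩
    · obtain rfl : i = j := hij
      refine ⟨i, Sym2.eq_iff.2 (Or.inl ⟨?_, ?_⟩)⟩ <;>
        simp only [Prod.mk.injEq, true_and, Fin.ext_iff, Fin.val_castSucc, Fin.val_succ] <;>
        dsimp only at hab <;> omega
    · dsimp only at hab h0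
      subst hab h0
      simp at hb
    · dsimp only at hab h4
      subst hab h4
      change 4 ≤ _ at ha
      omega

theorem isMatchingSet_range_pathEdge {k : ℕ} (f : Fin k → Fin 4) :
    IsMatchingSet (pathsBetweenCliques k) (Set.range fun i ↦ pathEdge i (f i)) := by
  refine ⟨?_, ?_⟩
  · rintro _ ⟨i, rfl⟩
    exact adj_castSucc_succ i (f i)
  · rintro _ ⟨i, rfl⟩ _ ⟨j, rfl⟩ hne v ⟨hi, hj⟩
    obtain rfl : i = j := (fst_eq_of_mem_pathEdge hi).symm.trans (fst_eq_of_mem_pathEdge hj)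
    exact hne rfl

theorem isMinimalMatchingCut_range_pathEdge {k : ℕ} (hk : 1 ≤ k) (f : Fin k → Fin 4) :
    IsMinimalMatchingCut (pathsBetweenCliques k) (Set.range fun i ↦ pathEdge i (f i)) := by
  refine ⟨⟨isMatchingSet_range_pathEdge f, _, ⟨(⟨0, hk⟩, 0), ?_⟩, ⟨(⟨0, hk⟩, 4), ?_⟩,
    range_pathEdge_eq_cutEdges f⟩, ?_⟩
  · exact Fin.zero_le _
  · have := (f ⟨0, hk⟩).isLt
    simp only [Set.mem_compl_iff, Set.mem_ofPred_eq, Fin.le_def, Fin.val_castSucc]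
    omega
  · rintro _ hss ⟨-, A, ⟨x, hx⟩, ⟨y, hy⟩, rfl⟩
    obtain ⟨_, ⟨j, rfl⟩, hj⟩ := Set.exists_of_ssubset hss
    have step (i : Fin k) (a : Fin 4) (h : a = f i → i = j) :
        (i, a.castSucc) ∈ A ↔ (i, a.succ) ∈ A := by
      refine mem_iff_mem_of_notMem_cutEdges (adj_castSucc_succ i a) fun hmem ↦ ?_
      obtain ⟨l, hl⟩ := hss.subset hmem
      obtain ⟨rfl, rfl⟩ := pathEdge_inj.1 hl
      obtain rfl := h rfl
      exact hj hmem
    have ends (i : Fin k) {a : Fin 5} (ha : a = 0 ∨ a = 4) : (i, a) ∈ A ↔ (j, a) ∈ A := by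
      obtain rfl | hij := eq_or_ne i j
      · rfl
      refine mem_iff_mem_of_notMem_cutEdges (adj_ends hij ha) fun hmem ↦ ?_
      obtain ⟨l, hl⟩ := hss.subset hmem
      exact mk_ne_pathEdge hij _ _ _ hl.symm
    have ends_eq : (j, (0 : Fin 5)) ∈ A ↔ (j, (4 : Fin 5)) ∈ A :=
      (step j 0 fun _ ↦ rfl).trans <| (step j 1 fun _ ↦ rfl).trans <|
        (step j 2 fun _ ↦ rfl).trans (step j 3 fun _ ↦ rfl)
    have all (i : Fin k) (a : Fin 5) : (i, a) ∈ A ↔ (j, 0) ∈ A := by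
      have h0 := ends i (Or.inl rfl)
      have h4 := ends i (Or.inr rfl)
      have s0 := step i 0
      have s1 := step i 1
      have s2 := step i 2
      have s3 := step i 3
      generalize f i = c at s0 s1 s2 s3
      fin_cases c <;> fin_cases a <;> simp_all
    exact hy ((all y.1 y.2).2 ((all x.1 x.2).1 hx))

/-- For every positive integer `k`, there exists a (finite) graph on exactly `5 * k`
vertices that has at least `4 ^ k` minimal matching cuts. -/
theorem exists_graph_card_minimalMatchingCuts (k : ℕ) (hk : 1 ≤ k) :
    ∃ (V : Type) (G : SimpleGraph V), Finite V ∧ Nat.card V = 5 * k ∧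
      4 ^ k ≤ Nat.card {M : Set (Sym2 V) // IsMinimalMatchingCut G M} := by
  refine ⟨Fin k × Fin 5, pathsBetweenCliques k, inferInstance, by simp [mul_comm], ?_⟩
  let cut (f : Fin k → Fin 4) : {M // IsMinimalMatchingCut (pathsBetweenCliques k) M} :=
    ⟨_, isMinimalMatchingCut_range_pathEdge hk f⟩
  have cut_injective : Function.Injective cut := fun f g hfg ↦ by
    funext i
    have hmem : pathEdge i (f i) ∈ Set.range fun j ↦ pathEdge j (g j) :=
      (Subtype.ext_iff.1 hfg).subset (Set.mem_range_self i)
    obtain ⟨j, hj⟩ := hmem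
    obtain ⟨rfl, h⟩ := pathEdge_inj.1 hj
    exact h.symm
  simpa using Nat.card_le_card_of_injective cut cut_injective

end MatchingCutPaper
end

section
/- For every integer k ≥ 2, there exists a graph whose vertex cover number equals k+2 and which has at least 2^k minimal matching cuts. -/
namespace MatchingCutPaper

/-- `X` is a vertex cover of `G`: every edge of `G` has at least one endpoint in `X`. -/
def IsVertexCover {V : Type} (G : SimpleGraph V) (X : Set V) : Prop :=
  ∀ e ∈ G.edgeSet, ∃ v ∈ X, v ∈ e

/-- The vertex cover number of `G`: the minimum size of a vertex cover of `G`. -/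
noncomputable def vertexCoverNumber {V : Type} (G : SimpleGraph V) : ℕ :=
  sInf {n : ℕ | ∃ X : Set V, IsVertexCover G X ∧ X.ncard = n}

/-- The vertices of `k` internally disjoint paths `s, u i, v i, w i, t` sharing their ends. -/
inductive PathVertex (k : ℕ) : Type
  | s : PathVertex k
  | t : PathVertex k
  | u (i : Fin k) : PathVertex k
  | v (i : Fin k) : PathVertex k
  | w (i : Fin k) : PathVertex k

namespace PathVertex

variable {k : ℕ}

/-- One step along one of the paths, from `s` towards `t`. -/
inductive Step : PathVertex k → PathVertex k → Prop
  | su (i : Fin k) : Step s (u i)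
  | uv (i : Fin k) : Step (u i) (v i)
  | vw (i : Fin k) : Step (v i) (w i)
  | wt (i : Fin k) : Step (w i) t

/-- The union of the `k` paths. -/
def pathsGraph (k : ℕ) : SimpleGraph (PathVertex k) := SimpleGraph.fromRel Step

instance : Finite (PathVertex k) := by
  let f : PathVertex k → Bool ⊕ Fin k ⊕ Fin k ⊕ Fin k
    | s => .inl false
    | t => .inl true
    | u i => .inr (.inl i)
    | v i => .inr (.inr (.inl i))
    | w i => .inr (.inr (.inr i))
  refine Finite.of_injective f fun a b h => ?_
  cases a <;> cases b <;> simp_all [f]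

theorem Step.adj {a b : PathVertex k} (h : Step a b) : (pathsGraph k).Adj a b := by
  rw [pathsGraph, SimpleGraph.fromRel_adj]
  exact ⟨by cases h <;> simp, .inl h⟩

theorem exists_step_of_mem_edgeSet {e : Sym2 (PathVertex k)} (he : e ∈ (pathsGraph k).edgeSet) :
    ∃ a b, Step a b ∧ e = s(a, b) := by
  induction e with
  | h a b =>
    rw [SimpleGraph.mem_edgeSet, pathsGraph, SimpleGraph.fromRel_adj] at he
    rcases he.2 with h | h
    · exact ⟨a, b, h, rfl⟩
    · exact ⟨b, a, h, Sym2.eq_swap⟩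

theorem isVertexCover_pathsGraph_iff {X : Set (PathVertex k)} :
    IsVertexCover (pathsGraph k) X ↔ ∀ a b, Step a b → a ∈ X ∨ b ∈ X := by
  constructor
  · intro h a b hab
    obtain ⟨x, hx, hxe⟩ := h s(a, b) hab.adj
    rcases Sym2.mem_iff.1 hxe with rfl | rfl
    · exact .inl hx
    · exact .inr hx
  · intro h e he
    obtain ⟨a, b, hab, rfl⟩ := exists_step_of_mem_edgeSet he
    rcases h a b hab with ha | hb
    · exact ⟨a, ha, Sym2.mem_mk_left a b⟩
    · exact ⟨b, hb, Sym2.mem_mk_right a b⟩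

theorem natCard_le_ncard_of_injective {ι V : Type} [Finite V] {X : Set V} (g : ι → V)
    (hg : Function.Injective g) (hX : ∀ i, g i ∈ X) : Nat.card ι ≤ X.ncard := by
  rw [← Nat.card_coe_set_eq]
  exact Nat.card_le_card_of_injective (fun i => (⟨g i, hX i⟩ : X))
    fun i j h => hg (congrArg Subtype.val h)

theorem le_ncard_of_isVertexCover (hk : 2 ≤ k) {X : Set (PathVertex k)}
    (hX : IsVertexCover (pathsGraph k) X) : k + 2 ≤ X.ncard := by
  rw [isVertexCover_pathsGraph_iff] at hX
  by_cases hs : s ∈ X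
  · by_cases ht : t ∈ X
    · have hc : ∀ i, ∃ c ∈ X, c = u i ∨ c = v i := fun i => by
        rcases hX _ _ (.uv i) with h | h
        · exact ⟨_, h, .inl rfl⟩
        · exact ⟨_, h, .inr rfl⟩
      choose c hcX hc using hc
      have := natCard_le_ncard_of_injective (X := X)
        (Sum.elim (fun b : Bool => if b then s else t) c)
        (by
          rintro (a | i) (b | j) h
          · cases a <;> cases b <;> simp_all
          · cases a <;> rcases hc j with h' | h' <;> simp_all
          · cases b <;> rcases hc i with h' | h' <;> simp_all
          · rcases hc i with h' | h' <;> rcases hc j with h'' | h'' <;> simp_all)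
        (by rintro ((_ | _) | i) <;> simp [*])
      simp at this
      omega
    · have hw : ∀ i, w i ∈ X := fun i => (hX _ _ (.wt i)).resolve_right ht
      have hc : ∀ i, ∃ c ∈ X, c = u i ∨ c = v i := fun i => by
        rcases hX _ _ (.uv i) with h | h
        · exact ⟨_, h, .inl rfl⟩
        · exact ⟨_, h, .inr rfl⟩
      choose c hcX hc using hc
      have := natCard_le_ncard_of_injective (X := X) (Sum.elim w c)
        (by
          rintro (i | i) (j | j) h
          · simp_all
          · rcases hc j with h' | h' <;> simp_all
          · rcases hc i with h' | h' <;> simp_all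
          · rcases hc i with h' | h' <;> rcases hc j with h'' | h'' <;> simp_all)
        (by rintro (i | i) <;> simp [*])
      simp at this
      omega
  · have hu : ∀ i, u i ∈ X := fun i => (hX _ _ (.su i)).resolve_left hs
    have hc : ∀ i, ∃ c ∈ X, c = v i ∨ c = w i := fun i => by
      rcases hX _ _ (.vw i) with h | h
      · exact ⟨_, h, .inl rfl⟩
      · exact ⟨_, h, .inr rfl⟩
    choose c hcX hc using hc
    have := natCard_le_ncard_of_injective (X := X) (Sum.elim u c)
      (by
        rintro (i | i) (j | j) h
        · simp_all
        · rcases hc j with h' | h' <;> simp_all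
        · rcases hc i with h' | h' <;> simp_all
        · rcases hc i with h' | h' <;> rcases hc j with h'' | h'' <;> simp_all)
      (by rintro (i | i) <;> simp [*])
    simp at this
    omega

theorem vertexCoverNumber_pathsGraph (hk : 2 ≤ k) : vertexCoverNumber (pathsGraph k) = k + 2 := by
  let g : Bool ⊕ Fin k → PathVertex k := Sum.elim (fun b => if b then s else t) v
  have hg : Function.Injective g := by
    rintro ((_ | _) | i) ((_ | _) | j) h <;> simp_all [g]
  have hmem : k + 2 ∈ {n | ∃ X, IsVertexCover (pathsGraph k) X ∧ X.ncard = n} := by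
    refine ⟨Set.range g, isVertexCover_pathsGraph_iff.2 fun a b hab => ?_, ?_⟩
    · cases hab with
      | su i => exact .inl ⟨.inl true, rfl⟩
      | uv i => exact .inr ⟨.inr i, rfl⟩
      | vw i => exact .inl ⟨.inr i, rfl⟩
      | wt i => exact .inr ⟨.inl false, rfl⟩
    · rw [← Nat.card_coe_set_eq, Nat.card_range_of_injective hg]
      simp [add_comm]
  refine le_antisymm (Nat.sInf_le hmem) (le_csInf ⟨_, hmem⟩ ?_)
  rintro n ⟨X, hX, rfl⟩
  exact le_ncard_of_isVertexCover hk hX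

theorem mk_mem_cutEdges_iff {V : Type} {G : SimpleGraph V} {A : Set V} {a b : V} :
    s(a, b) ∈ cutEdges G A ↔ G.Adj a b ∧ ¬(a ∈ A ↔ b ∈ A) := by
  simp only [cutEdges, Set.mem_ofPred_eq, SimpleGraph.mem_edgeSet]
  refine and_congr_right fun _ => ⟨?_, fun h => ?_⟩
  · rintro ⟨x, y, hxy, hx, hy⟩
    rcases Sym2.eq_iff.1 hxy with ⟨rfl, rfl⟩ | ⟨rfl, rfl⟩ <;> tauto
  · by_cases ha : a ∈ A
    · exact ⟨a, b, rfl, ha, by tauto⟩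
    · exact ⟨b, a, Sym2.eq_swap, by tauto, ha⟩

/-- The edge after `v i` if `f i` holds, and the edge before `v i` otherwise. -/
def middleEdge (f : Fin k → Bool) (i : Fin k) : Sym2 (PathVertex k) :=
  if f i then s(v i, w i) else s(u i, v i)

/-- The side of `s` in the cut formed by the edges `middleEdge f i`. -/
def sourceSide (f : Fin k → Bool) : Set (PathVertex k)
  | s => True
  | t => False
  | u _ => True
  | v i => f i
  | w _ => False

theorem uv_mem_range_middleEdge {f : Fin k → Bool} {i : Fin k} :
    s(u i, v i) ∈ Set.range (middleEdge f) ↔ f i = false := by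
  constructor
  · rintro ⟨j, hj⟩
    cases h : f j <;> simp_all [middleEdge]
  · intro h
    exact ⟨i, by simp [middleEdge, h]⟩

theorem vw_mem_range_middleEdge {f : Fin k → Bool} {i : Fin k} :
    s(v i, w i) ∈ Set.range (middleEdge f) ↔ f i = true := by
  constructor
  · rintro ⟨j, hj⟩
    cases h : f j <;> simp_all [middleEdge]
  · intro h
    exact ⟨i, by simp [middleEdge, h]⟩

theorem su_notMem_range_middleEdge {f : Fin k → Bool} {i : Fin k} :
    s(s, u i) ∉ Set.range (middleEdge f) := by
  rintro ⟨j, hj⟩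
  cases h : f j <;> simp_all [middleEdge]

theorem wt_notMem_range_middleEdge {f : Fin k → Bool} {i : Fin k} :
    s(w i, t) ∉ Set.range (middleEdge f) := by
  rintro ⟨j, hj⟩
  cases h : f j <;> simp_all [middleEdge]

theorem range_middleEdge_subset_edgeSet (f : Fin k → Bool) :
    Set.range (middleEdge f) ⊆ (pathsGraph k).edgeSet := by
  rintro _ ⟨i, rfl⟩
  unfold middleEdge
  split
  · exact (Step.vw i).adj
  · exact (Step.uv i).adj

theorem range_middleEdge_eq_cutEdges (f : Fin k → Bool) :
    Set.range (middleEdge f) = cutEdges (pathsGraph k) (sourceSide f) := by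
  have key : ∀ a b, Step a b →
      (s(a, b) ∈ Set.range (middleEdge f) ↔ s(a, b) ∈ cutEdges (pathsGraph k) (sourceSide f)) := by
    intro a b hab
    rw [mk_mem_cutEdges_iff, and_iff_right hab.adj]
    cases hab with
    | su i => exact iff_of_false su_notMem_range_middleEdge fun h => h (iff_of_true trivial trivial)
    | uv i =>
      rw [uv_mem_range_middleEdge]
      change _ ↔ ¬(True ↔ f i = true)
      simp
    | vw i =>
      rw [vw_mem_range_middleEdge]
      change _ ↔ ¬(f i = true ↔ False)
      simp
    | wt i => exact iff_of_false wt_notMem_range_middleEdge fun h => h (iff_of_false id id)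
  ext e
  constructor
  · intro he
    obtain ⟨a, b, hab, rfl⟩ := exists_step_of_mem_edgeSet (range_middleEdge_subset_edgeSet f he)
    exact (key a b hab).1 he
  · intro he
    obtain ⟨a, b, hab, rfl⟩ := exists_step_of_mem_edgeSet he.1
    exact (key a b hab).2 he

theorem isMatchingCut_range_middleEdge (f : Fin k → Bool) :
    IsMatchingCut (pathsGraph k) (Set.range (middleEdge f)) := by
  refine ⟨⟨range_middleEdge_subset_edgeSet f, ?_⟩, sourceSide f, ⟨s, trivial⟩, ⟨t, id⟩,
    range_middleEdge_eq_cutEdges f⟩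
  rintro _ ⟨i, rfl⟩ _ ⟨j, rfl⟩ hij x ⟨hi, hj⟩
  apply hij
  congr 1
  unfold middleEdge at hi hj
  split at hi <;> split at hj <;> simp only [Sym2.mem_iff] at hi hj <;>
    rcases hi with rfl | rfl <;> simp_all

theorem isMinimalMatchingCut_range_middleEdge (f : Fin k → Bool) :
    IsMinimalMatchingCut (pathsGraph k) (Set.range (middleEdge f)) := by
  refine ⟨isMatchingCut_range_middleEdge f, ?_⟩
  rintro M hM ⟨-, A, ⟨x, hx⟩, ⟨y, hy⟩, rfl⟩
  have same : ∀ {a b}, Step a b → s(a, b) ∉ cutEdges (pathsGraph k) A → (a ∈ A ↔ b ∈ A) := by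
    intro a b hab h
    by_contra hne
    exact h (mk_mem_cutEdges_iff.2 ⟨hab.adj, hne⟩)
  have su (i : Fin k) : s ∈ A ↔ u i ∈ A :=
    same (.su i) fun h => su_notMem_range_middleEdge (hM.1 h)
  have wt (i : Fin k) : w i ∈ A ↔ t ∈ A :=
    same (.wt i) fun h => wt_notMem_range_middleEdge (hM.1 h)
  have uv (i : Fin k) (hf : f i = true) : u i ∈ A ↔ v i ∈ A :=
    same (.uv i) fun h => by simpa [hf] using uv_mem_range_middleEdge.1 (hM.1 h)
  have vw (i : Fin k) (hf : f i = false) : v i ∈ A ↔ w i ∈ A :=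
    same (.vw i) fun h => by simpa [hf] using vw_mem_range_middleEdge.1 (hM.1 h)
  have hst : s ∈ A ↔ t ∈ A := by
    obtain ⟨_, ⟨j, rfl⟩, hj⟩ := Set.exists_of_ssubset hM
    cases hf : f j with
    | false =>
      have := same (.uv j) (by simpa [middleEdge, hf] using hj)
      rw [su j, this, vw j hf, wt j]
    | true =>
      have := same (.vw j) (by simpa [middleEdge, hf] using hj)
      rw [su j, uv j hf, this, wt j]
  have all : ∀ z, z ∈ A ↔ s ∈ A := by
    rintro (_ | _ | i | i | i)
    · rfl
    · exact hst.symm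
    · exact (su i).symm
    · cases hf : f i with
      | false => rw [vw i hf, wt i, hst]
      | true => rw [← uv i hf, su i]
    · rw [wt i, hst]
  exact hy ((all y).2 ((all x).1 hx))

theorem range_middleEdge_injective :
    Function.Injective fun f : Fin k → Bool => Set.range (middleEdge f) := by
  intro f g h
  funext i
  rw [Bool.eq_iff_iff, ← vw_mem_range_middleEdge, ← vw_mem_range_middleEdge]
  exact Set.ext_iff.1 h _

end PathVertex

/-- For every integer `k ≥ 2`, there exists a (finite) graph whose vertex cover number
equals `k + 2` and which has at least `2 ^ k` minimal matching cuts. -/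
theorem exists_graph_vc_minimalMatchingCuts (k : ℕ) (hk : 2 ≤ k) :
    ∃ (V : Type) (G : SimpleGraph V), Finite V ∧ vertexCoverNumber G = k + 2 ∧
      2 ^ k ≤ Nat.card {M : Set (Sym2 V) // IsMinimalMatchingCut G M} := by
  refine ⟨PathVertex k, PathVertex.pathsGraph k, inferInstance,
    PathVertex.vertexCoverNumber_pathsGraph hk, ?_⟩
  have := Nat.card_le_card_of_injective
    (fun f : Fin k → Bool => (⟨_, PathVertex.isMinimalMatchingCut_range_middleEdge f⟩ :
      {M // IsMinimalMatchingCut (PathVertex.pathsGraph k) M}))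
    fun f g h => PathVertex.range_middleEdge_injective (congrArg Subtype.val h)
  simpa using this

end MatchingCutPaper
end

section
/- Let G be a graph and let K be a clique of G with |K| ≠ 2 (that is, |K| = 1 or |K| ≥ 3). Then for every partition of the vertex set of G into two nonempty sets A and B such that E(A,B) is a matching, either K ⊆ A or K ⊆ B. -/
namespace MatchingCutPaper

/-- Let `K` be a clique of a graph `G` with `|K| ≠ 2`.  Then for every partition of the
vertex set into two nonempty parts `A` and `Aᶜ` such that `E(A, Aᶜ)` is a matching,
either `K ⊆ A` or `K ⊆ Aᶜ`. -/
theorem clique_subset_of_matching_cut {V : Type} [Fintype V] (G : SimpleGraph V)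
    (K : Set V) (hK : G.IsClique K) (hKcard : K.ncard ≠ 2)
    (A : Set V) (hA : A.Nonempty) (hAc : Aᶜ.Nonempty)
    (hmatch : IsMatchingSet G (cutEdges G A)) :
    K ⊆ A ∨ K ⊆ Aᶜ := by
  by_contra! h
  obtain ⟨y, hyK, hyA⟩ := Set.not_subset.mp h.1
  obtain ⟨x, hxK, hxA⟩ := Set.not_subset.mp h.2
  rw [Set.notMem_compl_iff] at hxA
  have hxy : x ≠ y := ne_of_mem_of_not_mem hxA hyA
  have mem_cut {u v : V} (huK : u ∈ K) (hvK : v ∈ K) (hu : u ∈ A) (hv : v ∉ A) :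
      s(u, v) ∈ cutEdges G A :=
    ⟨hK huK hvK (ne_of_mem_of_not_mem hu hv), u, v, rfl, hu, hv⟩
  have hK_eq : K = {x, y} := by
    refine Set.Subset.antisymm (fun z hzK => ?_) (Set.pair_subset hxK hyK)
    by_contra hz
    obtain ⟨hzx, hzy⟩ : z ≠ x ∧ z ≠ y := by simpa using hz
    by_cases hzA : z ∈ A
    · exact hmatch.2 _ (mem_cut hxK hyK hxA hyA) _ (mem_cut hzK hyK hzA hyA)
        (by simp [hzx.symm, hxy]) y (by simp)
    · exact hmatch.2 _ (mem_cut hxK hyK hxA hyA) _ (mem_cut hxK hzK hxA hzA)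
        (by simp [hzy.symm, hxy.symm]) x (by simp)
  exact hKcard (hK_eq ▸ Set.ncard_pair hxy)

end MatchingCutPaper
end

section
/- Let G be a connected graph and let U be a module of G with ∅ ≠ U ≠ V(G). Let Y be the set of vertices of U that have at least one neighbor inside U (i.e., the non-isolated vertices of the induced subgraph G[U]). Then for every partition of the vertex set of G into two nonempty sets A and B such that E(A,B) is a matching, either Y ⊆ A or Y ⊆ B. -/
namespace MatchingCutPaper

/-- A vertex has at most one neighbor on the other side of a matching cut. -/
theorem IsMatchingSet.eq_of_adj_of_separated {V : Type} {G : SimpleGraph V} {A : Set V}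
    (hmatch : IsMatchingSet G (cutEdges G A)) {u v w : V} (huv : G.Adj u v) (huw : G.Adj u w)
    (hv : u ∈ A ↔ v ∉ A) (hw : u ∈ A ↔ w ∉ A) : v = w := by
  have mem_cut : ∀ {x : V}, G.Adj u x → (u ∈ A ↔ x ∉ A) → s(u, x) ∈ cutEdges G A := by
    intro x hux hx
    refine ⟨hux, ?_⟩
    by_cases hu : u ∈ A
    · exact ⟨u, x, rfl, hu, hx.mp hu⟩
    · exact ⟨x, u, Sym2.eq_swap, by tauto, hu⟩
  by_contra hvw
  exact hmatch.2 _ (mem_cut huv hv) _ (mem_cut huw hw) (fun h => hvw (Sym2.congr_right.mp h)) u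
    ⟨Sym2.mem_mk_left u v, Sym2.mem_mk_left u w⟩

/-- No edge of a triangle is separated by a matching cut. -/
theorem IsMatchingSet.mem_iff_mem_of_triangle {V : Type} {G : SimpleGraph V} {A : Set V}
    (hmatch : IsMatchingSet G (cutEdges G A)) {u v w : V} (huv : G.Adj u v) (huw : G.Adj u w)
    (hvw : G.Adj v w) : u ∈ A ↔ v ∈ A := by
  by_contra h
  have hu := hmatch.eq_of_adj_of_separated huv huw
  have hv := hmatch.eq_of_adj_of_separated huv.symm hvw
  have := hvw.ne
  have := huw.ne
  tauto

/-- In a connected graph, some vertex outside a proper nonempty module is adjacent to all of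
it. -/
theorem exists_adj_all_of_module {V : Type} {G : SimpleGraph V} (hconn : G.Connected) {U : Set V}
    (hmod : ∀ v ∉ U, (∀ u ∈ U, G.Adj v u) ∨ (∀ u ∈ U, ¬ G.Adj v u))
    (hUne : U.Nonempty) (hUproper : U ≠ Set.univ) : ∃ v ∉ U, ∀ u ∈ U, G.Adj v u := by
  obtain ⟨x, hx⟩ := hUne
  obtain ⟨y, hy⟩ := (Set.ne_univ_iff_exists_notMem U).mp hUproper
  obtain ⟨p⟩ := hconn.preconnected x y
  obtain ⟨d, -, hfst, hsnd⟩ := p.exists_boundary_dart U hx hy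
  exact ⟨d.snd, hsnd, (hmod _ hsnd).resolve_right fun h => h _ hfst d.adj.symm⟩

/-- Let `G` be a connected graph and `U` a module of `G` with `∅ ≠ U ≠ V(G)`.  Let `Y` be
the set of vertices of `U` having at least one neighbor inside `U`.  Then for every
partition of the vertex set into two nonempty parts `A` and `Aᶜ` such that `E(A, Aᶜ)` is
a matching, either `Y ⊆ A` or `Y ⊆ Aᶜ`. -/
theorem module_core_subset_of_matching_cut {V : Type} [Fintype V] (G : SimpleGraph V)
    (hconn : G.Connected) (U : Set V)
    (hmod : ∀ v ∉ U, (∀ u ∈ U, G.Adj v u) ∨ (∀ u ∈ U, ¬ G.Adj v u))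
    (hUne : U.Nonempty) (hUproper : U ≠ Set.univ)
    (A : Set V) (hA : A.Nonempty) (hAc : Aᶜ.Nonempty)
    (hmatch : IsMatchingSet G (cutEdges G A)) :
    {u ∈ U | ∃ w ∈ U, G.Adj u w} ⊆ A ∨ {u ∈ U | ∃ w ∈ U, G.Adj u w} ⊆ Aᶜ := by
  obtain ⟨v, -, hv⟩ := exists_adj_all_of_module hconn hmod hUne hUproper
  have same_side : ∀ u ∈ {u ∈ U | ∃ w ∈ U, G.Adj u w}, v ∈ A ↔ u ∈ A := by
    rintro u ⟨hu, w, hw, huw⟩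
    exact hmatch.mem_iff_mem_of_triangle (hv u hu) (hv w hw) huw
  by_cases hvA : v ∈ A
  · exact Or.inl fun u hu => (same_side u hu).mp hvA
  · exact Or.inr fun u hu huA => hvA ((same_side u hu).mpr huA)

end MatchingCutPaper
end
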